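/- arXiv:1601.07744 — 2 statements merged into one kernel-verified Lean document; each statement's English description precedes it below -/
import Mathlib

section
/- Let λ, μ ∈ ℝ with μ > 0 and λ + μ > 0, set α := (λ+μ)/(λ+3μ) and c := −(λ+μ)/(λ+3μ), let R > 0 and let k ≥ 1 be an integer. Let u_k(x) = (r^k cos(kθ), −r^k sin(kθ)) and w_k(x) = R^{2k} ( r^{−k} cos(kθ) + kα(r²−R²) r^{−k−2} cos((k+2)θ), −r^{−k} sin(kθ) + kα(r²−R²) r^{−k−2} sin((k+2)θ) ) in polar coordinates. Then for every x with ‖x‖ = R, with ν := x/R: (i) u_k(x) = w_k(x), and (ii) c · [λ(∇·u_k)ν + μ(∇u_k + (∇u_k)ᵀ)ν](x) = [λ(∇·w_k)ν + μ(∇w_k + (∇w_k)ᵀ)ν](x), where the derivatives of u_k and of w_k are computed from their globally defined smooth formulas. -/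
open Real MeasureTheory

noncomputable section

/-- Partial derivative in the first coordinate direction. -/
def pdx (f : ℝ × ℝ → ℝ) (x : ℝ × ℝ) : ℝ := fderiv ℝ f x (1, 0)

/-- Partial derivative in the second coordinate direction. -/
def pdy (f : ℝ × ℝ → ℝ) (x : ℝ × ℝ) : ℝ := fderiv ℝ f x (0, 1)

/-- Divergence of a planar vector field. -/
def div2 (u : ℝ × ℝ → ℝ × ℝ) (x : ℝ × ℝ) : ℝ :=
  pdx (fun y => (u y).1) x + pdy (fun y => (u y).2) x

/-- Componentwise Laplacian. -/
def lap2 (f : ℝ × ℝ → ℝ) (x : ℝ × ℝ) : ℝ :=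
  pdx (fun y => pdx f y) x + pdy (fun y => pdy f y) x

/-- The Lamé operator  μ Δu + (λ+μ) ∇(∇·u). -/
def lame2 (lam mu : ℝ) (u : ℝ × ℝ → ℝ × ℝ) (x : ℝ × ℝ) : ℝ × ℝ :=
  (mu * lap2 (fun y => (u y).1) x + (lam + mu) * pdx (fun y => div2 u y) x,
   mu * lap2 (fun y => (u y).2) x + (lam + mu) * pdy (fun y => div2 u y) x)

/-- Conormal derivative  λ(∇·u)ν + μ(∇u + (∇u)ᵀ)ν. -/
def trac (lam mu : ℝ) (u : ℝ × ℝ → ℝ × ℝ) (x ν : ℝ × ℝ) : ℝ × ℝ :=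
  (lam * div2 u x * ν.1
      + mu * (2 * pdx (fun y => (u y).1) x * ν.1
        + (pdy (fun y => (u y).1) x + pdx (fun y => (u y).2) x) * ν.2),
   lam * div2 u x * ν.2
      + mu * ((pdy (fun y => (u y).1) x + pdx (fun y => (u y).2) x) * ν.1
        + 2 * pdy (fun y => (u y).2) x * ν.2))

/-- Entries of the symmetric gradient ∇ˢu = (∇u + (∇u)ᵀ)/2. -/
def sg11 (u : ℝ × ℝ → ℝ × ℝ) (x : ℝ × ℝ) : ℝ := pdx (fun y => (u y).1) x

def sg12 (u : ℝ × ℝ → ℝ × ℝ) (x : ℝ × ℝ) : ℝ :=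
  (pdy (fun y => (u y).1) x + pdx (fun y => (u y).2) x) / 2

def sg22 (u : ℝ × ℝ → ℝ × ℝ) (x : ℝ × ℝ) : ℝ := pdy (fun y => (u y).2) x

/-- Frobenius inner product ∇ˢu : ∇ˢv of the symmetric gradients of two fields. -/
def sgFrob (u v : ℝ × ℝ → ℝ × ℝ) (x : ℝ × ℝ) : ℝ :=
  sg11 u x * sg11 v x + 2 * (sg12 u x * sg12 v x) + sg22 u x * sg22 v x

/-- Euclidean norm on ℝ². -/
def nr (x : ℝ × ℝ) : ℝ := Real.sqrt (x.1 ^ 2 + x.2 ^ 2)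

/-- The identification of the real plane with `ℂ`. -/
def planeToComplex : ℝ × ℝ →L[ℝ] ℂ := Complex.equivRealProdCLM.symm

/-- The real-linear map `v ↦ a v + b v̄`, where `a` and `b` play the role of the Wirtinger
derivatives `∂_z` and `∂_z̄`. -/
def wirtingerCLM (a b : ℂ) : ℝ × ℝ →L[ℝ] ℂ :=
  a • planeToComplex + b • ((Complex.conjCLE : ℂ →L[ℝ] ℂ).comp planeToComplex)

lemma planeToComplex_apply (p : ℝ × ℝ) : planeToComplex p = p.1 + p.2 * Complex.I :=
  Complex.equivRealProdCLM_symm_apply p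

lemma wirtingerCLM_apply (a b : ℂ) (p : ℝ × ℝ) :
    wirtingerCLM a b p = a * planeToComplex p + b * star (planeToComplex p) := rfl

lemma planeToComplex_polar (r θ : ℝ) :
    planeToComplex (r * Real.cos θ, r * Real.sin θ) = r * Complex.exp (θ * Complex.I) := by
  rw [planeToComplex_apply, Complex.exp_mul_I]
  push_cast
  ring

lemma star_exp_ofReal_mul_I (θ : ℝ) :
    star (Complex.exp (θ * Complex.I)) = (Complex.exp (θ * Complex.I))⁻¹ := by
  rw [← Complex.exp_neg, Complex.star_def, ← Complex.exp_conj]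
  simp

lemma star_planeToComplex_polar (r θ : ℝ) :
    star (planeToComplex (r * Real.cos θ, r * Real.sin θ))
      = r * (Complex.exp (θ * Complex.I))⁻¹ := by
  rw [planeToComplex_polar, star_mul', star_exp_ofReal_mul_I, Complex.star_def,
    Complex.conj_ofReal]

lemma exists_polar (y : ℝ × ℝ) :
    ∃ r θ : ℝ, 0 ≤ r ∧ y = (r * Real.cos θ, r * Real.sin θ) := by
  refine ⟨‖planeToComplex y‖, (planeToComplex y).arg, norm_nonneg _, ?_⟩
  rw [Complex.norm_mul_cos_arg, Complex.norm_mul_sin_arg, planeToComplex_apply]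
  simp

lemma exp_pow_eq (n : ℕ) (θ : ℝ) :
    Complex.exp (θ * Complex.I) ^ n
      = (Real.cos (n * θ) : ℂ) + (Real.sin (n * θ) : ℂ) * Complex.I := by
  rw [← Complex.exp_nat_mul, ← mul_assoc, Complex.exp_mul_I]
  push_cast
  rfl

lemma exp_inv_pow_eq (n : ℕ) (θ : ℝ) :
    (Complex.exp (θ * Complex.I))⁻¹ ^ n
      = (Real.cos (n * θ) : ℂ) - (Real.sin (n * θ) : ℂ) * Complex.I := by
  rw [← star_exp_ofReal_mul_I, ← star_pow, exp_pow_eq]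
  simp [sub_eq_add_neg, -Complex.ofReal_cos, -Complex.ofReal_sin]

lemma hasFDerivAt_planeToComplex (x : ℝ × ℝ) :
    HasFDerivAt planeToComplex (wirtingerCLM 1 0) x := by
  refine planeToComplex.hasFDerivAt.congr_fderiv (ContinuousLinearMap.ext fun v => ?_)
  simp [wirtingerCLM_apply]

lemma hasFDerivAt_star_planeToComplex (x : ℝ × ℝ) :
    HasFDerivAt (fun y => star (planeToComplex y)) (wirtingerCLM 0 1) x := by
  refine ((Complex.conjCLE : ℂ →L[ℝ] ℂ).comp planeToComplex).hasFDerivAt.congr_fderiv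
    (ContinuousLinearMap.ext fun v => ?_)
  simp [wirtingerCLM_apply]

/-- The conormal derivative in terms of the Wirtinger derivatives `a`, `b` of the complex field:
`2 (λ + μ) Re(a) ν + 2 μ b ν̄`. -/
lemma trac_eq_of_hasFDerivAt {lam mu : ℝ} {u : ℝ × ℝ → ℝ × ℝ} {F : ℝ × ℝ → ℂ}
    {a b : ℂ} {x : ℝ × ℝ} (ν : ℝ × ℝ) (hF : HasFDerivAt F (wirtingerCLM a b) x)
    (huF : (fun y => planeToComplex (u y)) =ᶠ[nhds x] F) :
    planeToComplex (trac lam mu u x ν)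
      = (lam + mu) * (a + star a) * planeToComplex ν + 2 * mu * b * star (planeToComplex ν) := by
  have h := hF.congr_of_eventuallyEq huF
  have h1 : HasFDerivAt (fun y => (u y).1) (Complex.reCLM.comp (wirtingerCLM a b)) x := by
    refine (Complex.reCLM.hasFDerivAt.comp x h).congr_of_eventuallyEq
      (Filter.Eventually.of_forall fun y => ?_)
    simp [planeToComplex_apply]
  have h2 : HasFDerivAt (fun y => (u y).2) (Complex.imCLM.comp (wirtingerCLM a b)) x := by
    refine (Complex.imCLM.hasFDerivAt.comp x h).congr_of_eventuallyEq
      (Filter.Eventually.of_forall fun y => ?_)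
    simp [planeToComplex_apply]
  simp only [trac, div2, pdx, pdy, h1.fderiv, h2.fderiv]
  apply Complex.ext <;>
  · simp [wirtingerCLM_apply, planeToComplex_apply]
    ring

/-- The complex form `z̄ ^ k` of the interior field. -/
lemma hasFDerivAt_star_pow (k : ℕ) (x : ℝ × ℝ) :
    HasFDerivAt (fun y => star (planeToComplex y) ^ k)
      (wirtingerCLM 0 (k * star (planeToComplex x) ^ (k - 1))) x := by
  refine ((hasDerivAt_pow k _).comp_hasFDerivAt x
    (hasFDerivAt_star_planeToComplex x)).congr_fderiv (ContinuousLinearMap.ext fun v => ?_)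
  simp [wirtingerCLM_apply]

/-- The complex form of the exterior field. -/
def exteriorField (R α : ℝ) (k : ℕ) (z zc : ℂ) : ℂ :=
  R ^ (2 * k) * (z ^ (-k : ℤ) + k * α * ((z * zc - R ^ 2) * zc ^ (-(k + 2) : ℤ)))

lemma hasFDerivAt_exteriorField (R α : ℝ) (k : ℕ) {x : ℝ × ℝ} (hx : planeToComplex x ≠ 0) :
    HasFDerivAt (fun y => exteriorField R α k (planeToComplex y) (star (planeToComplex y)))
      (wirtingerCLM
        (R ^ (2 * k) * (-k * planeToComplex x ^ (-k - 1 : ℤ)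
          + k * α * (star (planeToComplex x) * star (planeToComplex x) ^ (-(k + 2) : ℤ))))
        (R ^ (2 * k) * (k * α * (planeToComplex x * star (planeToComplex x) ^ (-(k + 2) : ℤ)
          - (planeToComplex x * star (planeToComplex x) - R ^ 2)
            * ((k + 2) * star (planeToComplex x) ^ (-(k + 2) - 1 : ℤ)))))) x := by
  have hx' : star (planeToComplex x) ≠ 0 := star_ne_zero.mpr hx
  have hz := hasFDerivAt_planeToComplex x
  have hzc := hasFDerivAt_star_planeToComplex x
  have h1 := (hasDerivAt_zpow (-k : ℤ) _ (Or.inl hx)).comp_hasFDerivAt x hz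
  have h2 := (hasDerivAt_zpow (-(k + 2) : ℤ) _ (Or.inl hx')).comp_hasFDerivAt x hzc
  refine ((h1.add ((((hz.mul hzc).sub_const ((R : ℂ) ^ 2)).mul h2).const_mul
    ((k : ℂ) * α))).const_mul ((R : ℂ) ^ (2 * k))).congr_fderiv
    (ContinuousLinearMap.ext fun v => ?_)
  simp [wirtingerCLM_apply]
  ring

/-- across the circle ‖x‖ = R, the interior part u_k and exterior part w_k of the
perfect plasmon elastic wave ψ̂_k are continuous, and their conormal derivatives (computed from
the globally defined smooth formulas) match after multiplying the interior one by
c = −(λ+μ)/(λ+3μ). -/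
theorem plasmon_wave_transmission_conditions (lam mu : ℝ) (hmu : 0 < mu)
    (hlm : 0 < lam + mu) (α c : ℝ) (hα : α = (lam + mu) / (lam + 3 * mu))
    (hc : c = -((lam + mu) / (lam + 3 * mu)))
    (R : ℝ) (hR : 0 < R) (k : ℕ) (hk : 1 ≤ k)
    (u w : ℝ × ℝ → ℝ × ℝ)
    (hu : ∀ r θ : ℝ, 0 ≤ r →
      u (r * Real.cos θ, r * Real.sin θ)
        = (r ^ k * Real.cos ((k : ℝ) * θ), -(r ^ k * Real.sin ((k : ℝ) * θ))))
    (hw : ∀ r θ : ℝ, 0 < r →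
      w (r * Real.cos θ, r * Real.sin θ)
        = (R ^ (2 * k) * (Real.cos ((k : ℝ) * θ) / r ^ k
              + (k : ℝ) * α * (r ^ 2 - R ^ 2) * Real.cos (((k : ℝ) + 2) * θ) / r ^ (k + 2)),
           R ^ (2 * k) * (-(Real.sin ((k : ℝ) * θ) / r ^ k)
              + (k : ℝ) * α * (r ^ 2 - R ^ 2) * Real.sin (((k : ℝ) + 2) * θ) / r ^ (k + 2)))) :
    ∀ θ : ℝ,
      u (R * Real.cos θ, R * Real.sin θ) = w (R * Real.cos θ, R * Real.sin θ)
      ∧ c • trac lam mu u (R * Real.cos θ, R * Real.sin θ) (Real.cos θ, Real.sin θ)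
          = trac lam mu w (R * Real.cos θ, R * Real.sin θ) (Real.cos θ, Real.sin θ) := by
  have hden : lam + 3 * mu ≠ 0 := by linarith
  have hupol (r θ : ℝ) (hr : 0 ≤ r) :
      planeToComplex (u (r * Real.cos θ, r * Real.sin θ))
        = star (planeToComplex (r * Real.cos θ, r * Real.sin θ)) ^ k := by
    rw [hu r θ hr, star_planeToComplex_polar, mul_pow, exp_inv_pow_eq, planeToComplex_apply]
    push_cast
    ring
  have hwpol (r θ : ℝ) (hr : 0 < r) :
      planeToComplex (w (r * Real.cos θ, r * Real.sin θ))
        = exteriorField R α k (planeToComplex (r * Real.cos θ, r * Real.sin θ))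
          (star (planeToComplex (r * Real.cos θ, r * Real.sin θ))) := by
    have hr' : (r : ℂ) ≠ 0 := by exact_mod_cast hr.ne'
    have he := Complex.exp_ne_zero (θ * Complex.I)
    have e1 := exp_inv_pow_eq k θ
    have e2 := exp_pow_eq (k + 2) θ
    have z1 : ((r : ℂ) * Complex.exp (θ * Complex.I)) ^ (-k : ℤ)
        = (Complex.exp (θ * Complex.I))⁻¹ ^ k / r ^ k := by
      rw [zpow_neg, zpow_natCast, mul_pow, mul_inv, inv_pow]
      ring
    have z2 : ((r : ℂ) * (Complex.exp (θ * Complex.I))⁻¹) ^ (-(k + 2) : ℤ)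
        = Complex.exp (θ * Complex.I) ^ (k + 2) / r ^ (k + 2) := by
      rw [zpow_neg, show ((k : ℤ) + 2) = ((k + 2 : ℕ) : ℤ) by push_cast; rfl, zpow_natCast,
        mul_pow, mul_inv, inv_pow, inv_inv]
      ring
    have z3 : (r : ℂ) * Complex.exp (θ * Complex.I) * (r * (Complex.exp (θ * Complex.I))⁻¹)
        = r ^ 2 := by
      field_simp
    rw [hw r θ hr, star_planeToComplex_polar, planeToComplex_polar, planeToComplex_apply,
      exteriorField, z1, z2, z3, e1, e2]
    push_cast
    ring
  intro θ
  have hinj : Function.Injective planeToComplex := Complex.equivRealProdCLM.symm.injective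
  have hR' : (R : ℂ) ≠ 0 := by exact_mod_cast hR.ne'
  have he := Complex.exp_ne_zero (θ * Complex.I)
  have hx : planeToComplex (R * Real.cos θ, R * Real.sin θ) ≠ 0 := by
    rw [planeToComplex_polar]
    exact mul_ne_zero hR' he
  have huF : (fun y => planeToComplex (u y)) =ᶠ[nhds (R * Real.cos θ, R * Real.sin θ)]
      fun y => star (planeToComplex y) ^ k := by
    refine Filter.Eventually.of_forall fun y => ?_
    obtain ⟨r, φ, hr, rfl⟩ := exists_polar y
    exact hupol r φ hr
  have hwF : (fun y => planeToComplex (w y)) =ᶠ[nhds (R * Real.cos θ, R * Real.sin θ)]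
      fun y => exteriorField R α k (planeToComplex y) (star (planeToComplex y)) := by
    filter_upwards [planeToComplex.continuous.continuousAt.eventually_ne hx] with y hy
    obtain ⟨r, φ, hr, rfl⟩ := exists_polar y
    refine hwpol r φ (hr.lt_of_ne ?_)
    rintro rfl
    simp [planeToComplex_apply] at hy
  have hν : planeToComplex (Real.cos θ, Real.sin θ) = Complex.exp (θ * Complex.I) := by
    simpa using planeToComplex_polar 1 θ
  obtain ⟨n, rfl⟩ : ∃ n, k = n + 1 := ⟨k - 1, by omega⟩
  have hexp (m : ℕ) (z : ℂ) : z ^ (-(m : ℤ)) = (z ^ m)⁻¹ := by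
    rw [zpow_neg, zpow_natCast]
  constructor
  · apply hinj
    rw [hupol R θ hR.le, hwpol R θ hR, star_planeToComplex_polar, planeToComplex_polar,
      exteriorField, hexp]
    generalize Complex.exp (θ * Complex.I) = e at he ⊢
    simp only [mul_pow, inv_pow, mul_inv]
    field_simp
    ring
  · apply hinj
    rw [map_smul, trac_eq_of_hasFDerivAt _ (hasFDerivAt_star_pow _ _) huF,
      trac_eq_of_hasFDerivAt _ (hasFDerivAt_exteriorField R α _ hx) hwF, hν,
      star_exp_ofReal_mul_I]
    have hdenC : (lam : ℂ) + 3 * mu ≠ 0 := by exact_mod_cast hden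
    have s1 : (-((n + 1 : ℕ) : ℤ) - 1) = -((n + 2 : ℕ) : ℤ) := by push_cast; ring
    have s2 : (-(((n + 1 : ℕ) : ℤ) + 2)) = -((n + 3 : ℕ) : ℤ) := by push_cast; ring
    have s3 : (-((n + 3 : ℕ) : ℤ) - 1) = -((n + 4 : ℕ) : ℤ) := by push_cast; ring
    simp only [s1, s2, s3, hexp, planeToComplex_polar]
    simp only [star_mul', star_add, star_neg, star_pow, star_inv₀, star_exp_ofReal_mul_I,
      Complex.star_def, Complex.conj_ofReal, Complex.conj_natCast, Complex.real_smul, inv_inv,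
      map_zero, hα, hc, Nat.add_sub_cancel]
    push_cast
    generalize Complex.exp (θ * Complex.I) = e at he ⊢
    simp only [mul_pow, inv_pow, mul_inv, inv_inv]
    obtain ⟨d, hd⟩ : ∃ d : ℂ, (lam : ℂ) = d - 3 * mu := ⟨lam + 3 * mu, by ring⟩
    rw [hd, sub_add_cancel] at hdenC
    simp only [hd, sub_add_cancel]
    field_simp
    ring
end
end

section
/- Let k ≥ 1 be an integer and define p : ℝ² \ {0} → ℝ² in polar coordinates by p(x) = (r^{−k} cos(kθ), r^{−k} sin(kθ)). Then ∇·p = 0 on ℝ² \ {0}, each component of p is harmonic there, and consequently for all λ, μ ∈ ℝ the Lamé equation μ Δp + (λ+μ)∇(∇·p) = 0 holds at every point of ℝ² \ {0}. -/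
open Real MeasureTheory

noncomputable section

theorem pdx_congr {f g : ℝ × ℝ → ℝ} {x : ℝ × ℝ} (h : f =ᶠ[nhds x] g) :
    pdx f =ᶠ[nhds x] pdx g := by
  filter_upwards [h.fderiv (𝕜 := ℝ)] with y hy
  rw [pdx, pdx, hy]

theorem pdy_congr {f g : ℝ × ℝ → ℝ} {x : ℝ × ℝ} (h : f =ᶠ[nhds x] g) :
    pdy f =ᶠ[nhds x] pdy g := by
  filter_upwards [h.fderiv (𝕜 := ℝ)] with y hy
  rw [pdy, pdy, hy]

theorem lap2_congr {f g : ℝ × ℝ → ℝ} {x : ℝ × ℝ} (h : f =ᶠ[nhds x] g) :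
    lap2 f x = lap2 g x := by
  unfold lap2
  exact congrArg₂ (· + ·) (pdx_congr (pdx_congr h)).eq_of_nhds
    (pdy_congr (pdy_congr h)).eq_of_nhds

theorem pdx_eq_zero_of_eventually {f : ℝ × ℝ → ℝ} {x : ℝ × ℝ} (h : ∀ᶠ y in nhds x, f y = 0) :
    pdx f x = 0 := by
  rw [(pdx_congr (g := fun _ => 0) h).eq_of_nhds]
  simp [pdx]

theorem pdy_eq_zero_of_eventually {f : ℝ × ℝ → ℝ} {x : ℝ × ℝ} (h : ∀ᶠ y in nhds x, f y = 0) :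
    pdy f x = 0 := by
  rw [(pdy_congr (g := fun _ => 0) h).eq_of_nhds]
  simp [pdy]

theorem planeToComplex_apply_s11 (x : ℝ × ℝ) : planeToComplex x = ⟨x.1, x.2⟩ := by
  apply Complex.ext <;> simp [planeToComplex]

theorem hasFDerivAt_comp_planeToComplex {F : ℂ → ℂ} {x : ℝ × ℝ}
    (hF : DifferentiableAt ℂ F (planeToComplex x)) :
    HasFDerivAt (fun y => F (planeToComplex y))
      (deriv F (planeToComplex x) • planeToComplex) x := by
  have h := hF.hasDerivAt.complexToReal_fderiv.comp x planeToComplex.hasFDerivAt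
  refine h.congr_fderiv ?_
  ext <;> simp

theorem pdx_re {F : ℂ → ℂ} {x : ℝ × ℝ} (hF : DifferentiableAt ℂ F (planeToComplex x)) :
    pdx (fun y => (F (planeToComplex y)).re) x = (deriv F (planeToComplex x)).re := by
  have h := Complex.reCLM.hasFDerivAt.comp x (hasFDerivAt_comp_planeToComplex hF)
  have h' : fderiv ℝ (fun y => (F (planeToComplex y)).re) x = _ := h.fderiv
  rw [pdx, h']
  simp [planeToComplex_apply_s11]

theorem pdy_re {F : ℂ → ℂ} {x : ℝ × ℝ} (hF : DifferentiableAt ℂ F (planeToComplex x)) :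
    pdy (fun y => (F (planeToComplex y)).re) x = -(deriv F (planeToComplex x)).im := by
  have h := Complex.reCLM.hasFDerivAt.comp x (hasFDerivAt_comp_planeToComplex hF)
  have h' : fderiv ℝ (fun y => (F (planeToComplex y)).re) x = _ := h.fderiv
  rw [pdy, h']
  simp [planeToComplex_apply_s11]

theorem pdx_im {F : ℂ → ℂ} {x : ℝ × ℝ} (hF : DifferentiableAt ℂ F (planeToComplex x)) :
    pdx (fun y => (F (planeToComplex y)).im) x = (deriv F (planeToComplex x)).im := by
  have h := Complex.imCLM.hasFDerivAt.comp x (hasFDerivAt_comp_planeToComplex hF)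
  have h' : fderiv ℝ (fun y => (F (planeToComplex y)).im) x = _ := h.fderiv
  rw [pdx, h']
  simp [planeToComplex_apply_s11]

theorem pdy_im {F : ℂ → ℂ} {x : ℝ × ℝ} (hF : DifferentiableAt ℂ F (planeToComplex x)) :
    pdy (fun y => (F (planeToComplex y)).im) x = (deriv F (planeToComplex x)).re := by
  have h := Complex.imCLM.hasFDerivAt.comp x (hasFDerivAt_comp_planeToComplex hF)
  have h' : fderiv ℝ (fun y => (F (planeToComplex y)).im) x = _ := h.fderiv
  rw [pdy, h']
  simp [planeToComplex_apply_s11]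

theorem eventually_differentiableAt_planeToComplex {F : ℂ → ℂ} {x : ℝ × ℝ}
    (hF : AnalyticAt ℂ F (planeToComplex x)) :
    ∀ᶠ y in nhds x, DifferentiableAt ℂ F (planeToComplex y) :=
  planeToComplex.continuous.continuousAt.eventually
    (hF.eventually_analyticAt.mono fun _ h => h.differentiableAt)

theorem lap2_im {F : ℂ → ℂ} {x : ℝ × ℝ} (hF : AnalyticAt ℂ F (planeToComplex x)) :
    lap2 (fun y => (F (planeToComplex y)).im) x = 0 := by
  have hd := eventually_differentiableAt_planeToComplex hF
  have h1 : pdx (fun y => (F (planeToComplex y)).im) =ᶠ[nhds x]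
      fun y => (deriv F (planeToComplex y)).im := hd.mono fun _ => pdx_im
  have h2 : pdy (fun y => (F (planeToComplex y)).im) =ᶠ[nhds x]
      fun y => (deriv F (planeToComplex y)).re := hd.mono fun _ => pdy_im
  have hd' := hF.deriv.differentiableAt
  change pdx (pdx _) x + pdy (pdy _) x = 0
  rw [(pdx_congr h1).eq_of_nhds, (pdy_congr h2).eq_of_nhds, pdx_im hd', pdy_re hd',
    add_neg_cancel]

theorem lap2_re {F : ℂ → ℂ} {x : ℝ × ℝ} (hF : AnalyticAt ℂ F (planeToComplex x)) :
    lap2 (fun y => (F (planeToComplex y)).re) x = 0 := by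
  have h : AnalyticAt ℂ (fun z => Complex.I * F z) (planeToComplex x) :=
    analyticAt_const.mul hF
  simpa using lap2_im h

/-- If `F` is holomorphic, the conjugate field `(re F, -im F)` is divergence free. -/
theorem div2_conj {F : ℂ → ℂ} {x : ℝ × ℝ} (hF : DifferentiableAt ℂ F (planeToComplex x)) :
    div2 (fun y => ((F (planeToComplex y)).re, ((-F) (planeToComplex y)).im)) x = 0 := by
  change pdx _ x + pdy _ x = 0
  rw [pdx_re hF, pdy_im hF.neg, deriv.neg]
  simp

theorem inv_pow_polar (k : ℕ) {r : ℝ} (hr : 0 < r) (θ : ℝ) :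
    ((planeToComplex (r * Real.cos θ, r * Real.sin θ)) ^ k)⁻¹ =
      ⟨Real.cos (k * θ) / r ^ k, -(Real.sin (k * θ) / r ^ k)⟩ := by
  have hz : planeToComplex (r * Real.cos θ, r * Real.sin θ) =
      r * (Complex.cos θ + Complex.sin θ * Complex.I) := by
    apply Complex.ext <;>
      simp [planeToComplex_apply_s11, ← Complex.ofReal_cos, ← Complex.ofReal_sin]
  have hw : (⟨Real.cos (k * θ) / r ^ k, -(Real.sin (k * θ) / r ^ k)⟩ : ℂ) =
      (Complex.cos (k * θ) - Complex.sin (k * θ) * Complex.I) / r ^ k := by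
    rw [Complex.mk_eq_add_mul_I]
    push_cast
    ring
  have hr' : (r : ℂ) ≠ 0 := by exact_mod_cast hr.ne'
  rw [hz, hw, mul_pow, Complex.cos_add_sin_mul_I_pow]
  refine inv_eq_of_mul_eq_one_right ?_
  field_simp
  linear_combination Complex.cos_sq_add_sin_sq (k * θ) - Complex.sin (k * θ) ^ 2 * Complex.I_sq

/-- the field p(x) = (r^{−k} cos kθ, r^{−k} sin kθ) is divergence free on
ℝ² \ {0}, has harmonic components there, and satisfies the Lamé equation for all λ, μ. -/
theorem negative_power_field_divfree_harmonic_lame (k : ℕ) (hk : 1 ≤ k)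
    (p : ℝ × ℝ → ℝ × ℝ)
    (hp : ∀ r θ : ℝ, 0 < r →
      p (r * Real.cos θ, r * Real.sin θ)
        = (Real.cos ((k : ℝ) * θ) / r ^ k, Real.sin ((k : ℝ) * θ) / r ^ k)) :
    ∀ x : ℝ × ℝ, x ≠ 0 →
      div2 p x = 0
      ∧ lap2 (fun y => (p y).1) x = 0
      ∧ lap2 (fun y => (p y).2) x = 0
      ∧ ∀ lam mu : ℝ, lame2 lam mu p x = (0, 0) := by
  have polar : ∀ y : ℝ × ℝ, y ≠ 0 → p y =
      (((planeToComplex y ^ k)⁻¹).re, (-(planeToComplex y ^ k)⁻¹).im) := by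
    intro y hy
    have hy' : planeToComplex y ≠ 0 := by
      simpa [planeToComplex] using hy
    have hpos : 0 < ‖planeToComplex y‖ := norm_pos_iff.mpr hy'
    obtain ⟨r, θ, hr, rfl⟩ :
        ∃ r θ : ℝ, 0 < r ∧ y = (r * Real.cos θ, r * Real.sin θ) := by
      refine ⟨‖planeToComplex y‖, (planeToComplex y).arg, hpos, ?_⟩
      rw [Complex.norm_mul_cos_arg, Complex.norm_mul_sin_arg, planeToComplex_apply_s11]
    rw [hp r θ hr, inv_pow_polar k hr]
    simp
  have near : ∀ y : ℝ × ℝ, y ≠ 0 → p =ᶠ[nhds y] fun z =>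
      (((planeToComplex z ^ k)⁻¹).re, (-(planeToComplex z ^ k)⁻¹).im) := fun y hy =>
    Filter.mem_of_superset (isOpen_ne.mem_nhds hy) polar
  have analytic : ∀ y : ℝ × ℝ, y ≠ 0 →
      AnalyticAt ℂ (fun z : ℂ => (z ^ k)⁻¹) (planeToComplex y) := by
    intro y hy
    refine (analyticAt_id.pow k).inv (pow_ne_zero k ?_)
    simpa [planeToComplex] using hy
  have hdiv : ∀ y : ℝ × ℝ, y ≠ 0 → div2 p y = 0 := by
    intro y hy
    rw [← div2_conj (analytic y hy).differentiableAt]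
    exact congrArg₂ (· + ·)
      (pdx_congr ((near y hy).fun_comp Prod.fst)).eq_of_nhds
      (pdy_congr ((near y hy).fun_comp Prod.snd)).eq_of_nhds
  intro x hx
  have h1 : lap2 (fun y => (p y).1) x = 0 :=
    (lap2_congr ((near x hx).fun_comp Prod.fst)).trans (lap2_re (analytic x hx))
  have h2 : lap2 (fun y => (p y).2) x = 0 :=
    (lap2_congr ((near x hx).fun_comp Prod.snd)).trans (lap2_im (analytic x hx).neg)
  have hdiv' : ∀ᶠ y in nhds x, div2 p y = 0 := Filter.mem_of_superset (isOpen_ne.mem_nhds hx) hdiv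
  refine ⟨hdiv x hx, h1, h2, fun lam mu => ?_⟩
  simp only [lame2, h1, h2, pdx_eq_zero_of_eventually hdiv', pdy_eq_zero_of_eventually hdiv',
    mul_zero, add_zero]
end
end
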